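/- arXiv:1401.1393 — 3 statements merged into one kernel-verified Lean document; each statement's English description precedes it below -/
import Mathlib

section
/- Suppose X is regular and S is a proper dyadic subbase of X, and let D be either D_S or D̂_S. If p ∈ L(D) and x ∈ X are such that p and x̃ are compatible in 𝕋^ω, then x̃ ⊑ p. In particular, X̃ ⊆ min(L(D)): every x̃ is a minimal element of L(D). (Theorem 6.3) -/
open Set Topology TopologicalSpace

/-- The three-element set 𝕋 = {0, 1, ⊥}. `digit b` is a digit (0 or 1), `bot` is ⊥. -/
inductive TT where
  | bot : TT
  | digit : Bool → TT
  deriving DecidableEq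

/-- The topology on 𝕋 whose open sets are ∅, {0}, {1}, {0,1}, 𝕋. -/
instance : TopologicalSpace TT :=
  generateFrom {{TT.digit false}, {TT.digit true}}

/-- The pointwise order ⊑ on 𝕋^ω (⊥ ⊑ 0, ⊥ ⊑ 1, digits incomparable). -/
def TLe (p q : ℕ → TT) : Prop := ∀ k (b : Bool), p k = TT.digit b → q k = TT.digit b

/-- Compatibility in 𝕋^ω: existence of a common upper bound. -/
def TCompat (p q : ℕ → TT) : Prop := ∃ r, TLe p r ∧ TLe q r

/-- dom(p) = the set of positions where p has a digit. -/
def Tdom (p : ℕ → TT) : Set ℕ := {k | p k ≠ TT.bot}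

/-- p is a finite bottomed sequence (an element of 𝕋^*). -/
def TFin (p : ℕ → TT) : Prop := (Tdom p).Finite

/-- The truncation p|_n. -/
def trunc (p : ℕ → TT) (n : ℕ) : ℕ → TT := fun k => if k < n then p k else TT.bot

/-- The pointwise least upper bound of two (compatible) bottomed sequences. -/
def tsup (d e : ℕ → TT) : ℕ → TT := fun k => if d k = TT.bot then e k else d k

/-- A dyadic subbase of X: a family of regular open sets, pairwise exteriors,
forming a subbase of the topology of X. -/
structure DyadicSubbase (X : Type*) [t : TopologicalSpace X] where
  S : ℕ → Bool → Set X
  regOpen : ∀ n a, S n a = interior (closure (S n a))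
  compl : ∀ n, S n true = (closure (S n false))ᶜ
  subbase : generateFrom {U | ∃ n a, U = S n a} = t

variable {X : Type*} [TopologicalSpace X]

open Classical in
/-- The embedding φ_S : X → 𝕋^ω. -/
noncomputable def phi (D : DyadicSubbase X) (x : X) : ℕ → TT := fun n =>
  if x ∈ D.S n false then TT.digit false
  else if x ∈ D.S n true then TT.digit true
  else TT.bot

/-- S(p) = ⋂_{k ∈ dom p} S_{k, p(k)}. -/
def Sint (D : DyadicSubbase X) (p : ℕ → TT) : Set X :=
  {x | ∀ k (b : Bool), p k = TT.digit b → x ∈ D.S k b}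

/-- S̄(p) = ⋂_{k ∈ dom p} cl(S_{k, p(k)}). -/
def SbarInt (D : DyadicSubbase X) (p : ℕ → TT) : Set X :=
  {x | ∀ k (b : Bool), p k = TT.digit b → x ∈ closure (D.S k b)}

/-- S is a proper dyadic subbase: cl(S(e)) = S̄(e) for all finite bottomed e. -/
def IsProperDS (D : DyadicSubbase X) : Prop :=
  ∀ e, TFin e → closure (Sint D e) = SbarInt D e

/-- ↑X̃ = {p : x̃ ⊑ p for some x}. -/
def upX (D : DyadicSubbase X) : Set (ℕ → TT) := {p | ∃ x, TLe (phi D x) p}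

/-- 2^ω, the bottom-free sequences. -/
def twoOmega : Set (ℕ → TT) := {p | ∀ k, p k ≠ TT.bot}

/-- K_S = {x̃|_m : x ∈ X, m ∈ ℕ}. -/
def KS (D : DyadicSubbase X) : Set (ℕ → TT) := {e | ∃ x m, e = trunc (phi D x) m}

/-- K̂_S = {p|_m : p ∈ ↑X̃, m ∈ ℕ}. -/
def KhatS (D : DyadicSubbase X) : Set (ℕ → TT) := {e | ∃ p ∈ upX D, ∃ m, e = trunc p m}

/-- I is an ideal of the subposet K of 𝕋^ω. -/
def IsIdealOf (K I : Set (ℕ → TT)) : Prop :=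
  I ⊆ K ∧ I.Nonempty ∧ (∀ d ∈ I, ∀ e ∈ I, ∃ f ∈ I, TLe d f ∧ TLe e f) ∧
    (∀ d ∈ K, ∀ e ∈ I, TLe d e → d ∈ I)

/-- p is the pointwise least upper bound of the set I in 𝕋^ω. -/
def IsSupOf (I : Set (ℕ → TT)) (p : ℕ → TT) : Prop :=
  ∀ k (b : Bool), p k = TT.digit b ↔ ∃ e ∈ I, e k = TT.digit b

/-- D_S ⊆ 𝕋^ω: least upper bounds of ideals of K_S. -/
def DS (D : DyadicSubbase X) : Set (ℕ → TT) := {p | ∃ I, IsIdealOf (KS D) I ∧ IsSupOf I p}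

/-- D̂_S ⊆ 𝕋^ω: least upper bounds of ideals of K̂_S. -/
def DhatS (D : DyadicSubbase X) : Set (ℕ → TT) := {p | ∃ I, IsIdealOf (KhatS D) I ∧ IsSupOf I p}

/-- The limit (non-compact) elements of a subdomain E of 𝕋^ω:
those with infinite domain. -/
def limitsOf (E : Set (ℕ → TT)) : Set (ℕ → TT) := {p ∈ E | (Tdom p).Infinite}

/-- The minimal elements of a subset A of 𝕋^ω. -/
def minOf (A : Set (ℕ → TT)) : Set (ℕ → TT) := {p ∈ A | ∀ q ∈ A, TLe q p → q = p}

/-- q is an immediate successor of p in the subposet K of 𝕋^ω. -/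
def ImmSucc (K : Set (ℕ → TT)) (p q : ℕ → TT) : Prop :=
  p ∈ K ∧ q ∈ K ∧ TLe p q ∧ p ≠ q ∧ ¬∃ r ∈ K, TLe p r ∧ p ≠ r ∧ TLe r q ∧ r ≠ q

/-- A Hausdorff space is adhesive if it has at least two points and the closures
of any two nonempty open sets intersect. -/
def Adhesive (Y : Type*) [TopologicalSpace Y] : Prop :=
  (∃ y z : Y, y ≠ z) ∧
    ∀ U V : Set Y, IsOpen U → IsOpen V → U.Nonempty → V.Nonempty →
      (closure U ∩ closure V).Nonempty

/-- A space is strongly nonadhesive if every open subspace is nonadhesive. -/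
def StronglyNonadhesive (Y : Type*) [TopologicalSpace Y] : Prop :=
  ∀ U : Set Y, IsOpen U → ¬ Adhesive U
theorem phi_eq_iff' (D : DyadicSubbase X) (x : X) (n : ℕ) (b : Bool) :
    phi D x n = TT.digit b ↔ x ∈ D.S n b := by
  have hdis : x ∈ D.S n false → x ∈ D.S n true → False := by
    intro h0 h1
    rw [D.compl n] at h1
    exact h1 (subset_closure h0)
  unfold phi
  cases b <;> by_cases h0 : x ∈ D.S n false <;> by_cases h1 : x ∈ D.S n true <;> simp [h0, h1]
  all_goals exact hdis h0 h1

theorem S_open' (D : DyadicSubbase X) (n : ℕ) (b : Bool) : IsOpen (D.S n b) := by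
  rw [D.regOpen n b]; exact isOpen_interior

theorem mem_closure_or' (D : DyadicSubbase X) (x : X) (n : ℕ) (b : Bool)
    (h : x ∉ closure (D.S n b)) : x ∈ D.S n (!b) := by
  cases b
  · simp only [Bool.not_false]; rw [D.compl n]; exact h
  · simp only [Bool.not_true]
    rw [D.regOpen n false, ← compl_compl (closure (D.S n false)), ← D.compl n, interior_compl]
    exact h

theorem trunc_digit' (p : ℕ → TT) (m k : ℕ) (b : Bool) :
    trunc p m k = TT.digit b ↔ k < m ∧ p k = TT.digit b := by
  unfold trunc; split_ifs with h <;> simp [h]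

theorem trunc_fin' (p : ℕ → TT) (m : ℕ) : TFin (trunc p m) := by
  refine (Set.finite_Iio m).subset ?_
  intro k hk
  by_contra h
  apply hk
  simp only [mem_Iio] at h
  simp [trunc, h]

theorem nbhd' (D : DyadicSubbase X) (x : X) (U : Set X) (hU : IsOpen U) (hx : x ∈ U) :
    ∃ m, Sint D (trunc (phi D x) m) ⊆ U := by
  have hU' : GenerateOpen {U | ∃ n a, U = D.S n a} U := by
    have h2 : IsOpen[generateFrom {U | ∃ n a, U = D.S n a}] U := by
      rw [D.subbase]; exact hU
    exact h2
  clear hU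
  induction hU' with
  | basic s hs =>
    obtain ⟨n, a, rfl⟩ := hs
    refine ⟨n + 1, fun y hy => hy n a ?_⟩
    rw [trunc_digit']
    exact ⟨Nat.lt_succ_self n, (phi_eq_iff' D x n a).2 hx⟩
  | univ => exact ⟨0, subset_univ _⟩
  | inter s t _ _ ihs iht =>
    obtain ⟨m, hm⟩ := ihs hx.1
    obtain ⟨l, hl⟩ := iht hx.2
    refine ⟨max m l, fun y hy => ⟨hm fun k b h => hy k b ?_, hl fun k b h => hy k b ?_⟩⟩
    all_goals
      rw [trunc_digit'] at h ⊢
      exact ⟨by omega, h.2⟩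
  | sUnion C _ ih =>
    obtain ⟨s, hs, hxs⟩ := hx
    obtain ⟨m, hm⟩ := ih s hs hxs
    exact ⟨m, fun y hy => ⟨s, hs, hm hy⟩⟩

theorem TT_ne_bot' (t : TT) (h : t ≠ TT.bot) : ∃ b, t = TT.digit b := by
  cases t with
  | bot => exact absurd rfl h
  | digit b => exact ⟨b, rfl⟩

theorem TLe_antisymm' (p q : ℕ → TT) (h : TLe p q) (h' : TLe q p) : p = q := by
  funext k
  by_cases hp : p k = TT.bot
  · by_cases hq : q k = TT.bot
    · rw [hp, hq]
    · obtain ⟨b, hb⟩ := TT_ne_bot' _ hq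
      rw [hb, h' k b hb]
  · obtain ⟨b, hb⟩ := TT_ne_bot' _ hp
    rw [hb, h k b hb]

theorem phi_inf' [T2Space X] (D : DyadicSubbase X) (x : X) : (Tdom (phi D x)).Infinite := by
  intro hfin
  obtain ⟨M, hM⟩ := hfin.bddAbove
  have hsub : Sint D (phi D x) ⊆ {x} := by
    intro y hy
    by_contra hne
    obtain ⟨m, hm⟩ := nbhd' D x {y}ᶜ isOpen_compl_singleton (fun h => hne (Eq.symm h))
    exact hm (fun k b h => hy k b ((trunc_digit' _ _ _ _).1 h).2) rfl
  have hopen : IsOpen (Sint D (phi D x)) := by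
    have : Sint D (phi D x) = ⋂ k ∈ Tdom (phi D x), ⋂ b, ⋂ (_ : phi D x k = TT.digit b), D.S k b := by
      ext y
      simp only [Sint, mem_setOf_eq, mem_iInter]
      exact ⟨fun h k _ b hb => h k b hb, fun h k b hb => h k (by simp [Tdom, hb]) b hb⟩
    rw [this]
    refine hfin.isOpen_biInter fun k _ => ?_
    refine isOpen_iInter_of_finite fun b => isOpen_iInter_of_finite fun _ => S_open' D k b
  have hxm : x ∈ Sint D (phi D x) := fun k b h => (phi_eq_iff' D x k b).1 h
  have hall : ∀ n, n ∈ Tdom (phi D x) := by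
    intro n
    by_cases h : x ∈ closure (D.S n false)
    · obtain ⟨z, hz, hz'⟩ := mem_closure_iff.1 h _ hopen hxm
      have hzx : z = x := hsub hz
      rw [hzx] at hz'
      simp [Tdom, (phi_eq_iff' D x n false).2 hz']
    · have := mem_closure_or' D x n false h
      simp [Tdom, (phi_eq_iff' D x n _).2 this]
  have := hM (hall (M + 1))
  omega

theorem main' [RegularSpace X] (D : DyadicSubbase X) (hD : IsProperDS D)
    (I : Set (ℕ → TT)) (hI : I ⊆ KhatS D) (p : ℕ → TT) (hp : IsSupOf I p)
    (hinf : (Tdom p).Infinite) (x : X) (hc : TCompat p (phi D x)) : TLe (phi D x) p := by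
  intro n a hna
  have hxn := (phi_eq_iff' D x n a).1 hna
  obtain ⟨r, hpr, hxr⟩ := hc
  by_contra hpn
  obtain ⟨C, hC, hCc, hCs⟩ := exists_mem_nhds_isClosed_subset ((S_open' D n a).mem_nhds hxn)
  obtain ⟨m, hm⟩ := nbhd' D x (interior C) isOpen_interior (mem_interior_iff_mem_nhds.2 hC)
  have hcl : closure (Sint D (trunc (phi D x) m)) ⊆ D.S n a :=
    (closure_minimal (hm.trans interior_subset) hCc).trans hCs
  obtain ⟨k, hk, hkm⟩ := hinf.exists_gt (max m n)
  obtain ⟨b, hb⟩ := TT_ne_bot' _ hk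
  obtain ⟨d, hdI, hdk⟩ := (hp k b).1 hb
  obtain ⟨q, ⟨y, hyq⟩, j, rfl⟩ := hI hdI
  have hj := ((trunc_digit' _ _ _ _).1 hdk).1
  -- below j, the digits of y agree with those of p
  have hyp : ∀ i c, i < j → y ∈ D.S i c → p i = TT.digit c := by
    intro i c hi hy
    refine (hp i c).2 ⟨_, hdI, (trunc_digit' _ _ _ _).2 ⟨hi, hyq i c ((phi_eq_iff' D y i c).2 hy)⟩⟩
  have hy : y ∈ closure (Sint D (trunc (phi D x) m)) := by
    rw [hD _ (trunc_fin' _ _)]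
    intro i c hic
    rw [trunc_digit'] at hic
    by_contra hcon
    have h1 := hpr i _ (hyp i _ (by omega) (mem_closure_or' D y i c hcon))
    have h2 := hxr i c hic.2
    rw [h1] at h2
    cases c <;> simp at h2
  exact hpn (hyp n a (by omega) (hcl hy))

theorem phi_mem' (D : DyadicSubbase X) (K : Set (ℕ → TT)) (hK : KS D ⊆ K) (x : X) :
    ∃ I, IsIdealOf K I ∧ IsSupOf I (phi D x) := by
  have hin : ∀ m, trunc (phi D x) m ∈ K := fun m => hK ⟨x, m, rfl⟩
  refine ⟨{e | e ∈ K ∧ ∃ m, TLe e (trunc (phi D x) m)}, ⟨fun e he => he.1,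
    ⟨trunc (phi D x) 0, hin 0, 0, fun _ _ h => h⟩, ?_, ?_⟩, ?_⟩
  · rintro d ⟨_, m, hm⟩ e ⟨_, l, hl⟩
    refine ⟨trunc (phi D x) (max m l), ⟨hin _, _, fun _ _ h => h⟩, ?_, ?_⟩
    · intro k b h
      have := (trunc_digit' _ _ _ _).1 (hm k b h)
      exact (trunc_digit' _ _ _ _).2 ⟨by omega, this.2⟩
    · intro k b h
      have := (trunc_digit' _ _ _ _).1 (hl k b h)
      exact (trunc_digit' _ _ _ _).2 ⟨by omega, this.2⟩
  · rintro d hd e ⟨_, m, hm⟩ hde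
    exact ⟨hd, m, fun k b h => hm k b (hde k b h)⟩
  · intro k b
    constructor
    · intro h
      exact ⟨trunc (phi D x) (k + 1), ⟨hin _, k + 1, fun _ _ h => h⟩,
        (trunc_digit' _ _ _ _).2 ⟨by omega, h⟩⟩
    · rintro ⟨e, ⟨_, m, hm⟩, he⟩
      exact ((trunc_digit' _ _ _ _).1 (hm k b he)).2

theorem KS_sub' (D : DyadicSubbase X) : KS D ⊆ KhatS D := by
  rintro e ⟨x, m, rfl⟩
  exact ⟨phi D x, ⟨x, fun _ _ h => h⟩, m, rfl⟩

/-- Theorem 6.3: if X is regular and S proper, D ∈ {D_S, D̂_S}: any p ∈ L(D)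
compatible with x̃ lies above x̃; in particular X̃ ⊆ min(L(D)). -/
theorem stmt_17 {X : Type*} [TopologicalSpace X] [T2Space X] [SecondCountableTopology X]
    [RegularSpace X] (D : DyadicSubbase X) (hD : IsProperDS D)
    (E : Set (ℕ → TT)) (hE : E = DS D ∨ E = DhatS D) :
    (∀ p ∈ limitsOf E, ∀ x : X, TCompat p (phi D x) → TLe (phi D x) p) ∧
    Set.range (phi D) ⊆ minOf (limitsOf E) := by
  have key : ∀ p ∈ limitsOf E, ∀ x : X, TCompat p (phi D x) → TLe (phi D x) p := by
    rintro p ⟨hpE, hinf⟩ x hc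
    rcases hE with rfl | rfl
    · obtain ⟨I, hI, hs⟩ := hpE
      exact main' D hD I (hI.1.trans (KS_sub' D)) p hs hinf x hc
    · obtain ⟨I, hI, hs⟩ := hpE
      exact main' D hD I hI.1 p hs hinf x hc
  refine ⟨key, ?_⟩
  rintro _ ⟨x, rfl⟩
  refine ⟨⟨?_, phi_inf' D x⟩, fun q hq hle => ?_⟩
  · rcases hE with rfl | rfl
    · exact phi_mem' D _ subset_rfl x
    · exact phi_mem' D _ (KS_sub' D) x
  · exact TLe_antisymm' _ _ hle (key q hq x ⟨phi D x, hle, fun _ _ h => h⟩)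
end

section
/- Suppose X is a compact (second-countable Hausdorff) space and S is a proper dyadic subbase of X, and let D be either D_S or D̂_S. Then X̃ = min(L(D)); moreover L(D) ⊆ ↑X̃, and the restriction of ρ_S to L(D) is a continuous map onto X satisfying ρ_S(x̃) = x for all x ∈ X, so that together with the continuous embedding φ_S : X → L(D) it exhibits X as a retract of L(D). (Theorem 6.4) -/
open Set Topology TopologicalSpace

variable {X : Type*} [TopologicalSpace X]

open Set Topology TopologicalSpace

namespace Aux18


theorem S_open (D : DyadicSubbase X) (n : ℕ) (a : Bool) : IsOpen (D.S n a) := by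
  rw [D.regOpen]; exact isOpen_interior

theorem cl_eq (D : DyadicSubbase X) (n : ℕ) (a : Bool) : closure (D.S n a) = (D.S n (!a))ᶜ := by
  cases a
  · simp [D.compl n]
  · rw [D.compl n, closure_compl, ← D.regOpen n false]; rfl

theorem phi_iff (D : DyadicSubbase X) (x : X) (n : ℕ) (b : Bool) :
    phi D x n = TT.digit b ↔ x ∈ D.S n b := by
  have hd : x ∈ D.S n true → x ∉ D.S n false := by
    intro h h'
    rw [D.compl n] at h
    exact h (subset_closure h')
  unfold phi
  cases b
  · split_ifs <;> simp_all
  · split_ifs with h1 h2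
    · simp; exact fun h => hd h h1
    · simp_all
    · simp_all

theorem dig (t : TT) : t = TT.bot ∨ ∃ b, t = TT.digit b := by
  cases t <;> simp

theorem TLe.antisymm {p q : ℕ → TT} (h : TLe p q) (h' : TLe q p) : p = q := by
  funext k
  rcases dig (p k) with hp | ⟨b, hp⟩
  · rcases dig (q k) with hq | ⟨b, hq⟩
    · rw [hp, hq]
    · rw [h' k b hq, hq]
  · rw [h k b hp, hp]

theorem TLe.trans {p q r : ℕ → TT} (h : TLe p q) (h' : TLe q r) : TLe p r :=
  fun k b e => h' k b (h k b e)

theorem TLe.rfl {p : ℕ → TT} : TLe p p := fun _ _ h => h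

theorem trunc_iff (p : ℕ → TT) (n k : ℕ) (b : Bool) :
    trunc p n k = TT.digit b ↔ k < n ∧ p k = TT.digit b := by
  unfold trunc; split_ifs with h <;> simp [h]

theorem mem_Sbar (D : DyadicSubbase X) {x : X} {p : ℕ → TT} (h : TLe (phi D x) p) :
    x ∈ SbarInt D p := by
  intro k b hb
  rw [cl_eq]
  intro hx
  have := h k _ ((phi_iff D x k (!b)).2 hx)
  rw [hb] at this
  cases b <;> simp at this

theorem dom_infinite (D : DyadicSubbase X)
    (ρ : (ℕ → TT) → X) (hρ : ∀ p ∈ upX D, SbarInt D p = {ρ p}) (x : X) :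
    (Tdom (phi D x)).Infinite := by
  intro hfin
  have hopen : IsOpen (⋂ k ∈ Tdom (phi D x), {y : X | ∀ b, phi D x k = TT.digit b → y ∈ D.S k b}) := by
    refine hfin.isOpen_biInter fun k _ => ?_
    rcases dig (phi D x k) with h | ⟨b, h⟩
    · simp [h]
    · simp [h, S_open]
  have hx : {x} = (⋂ k ∈ Tdom (phi D x), {y : X | ∀ b, phi D x k = TT.digit b → y ∈ D.S k b}) := by
    apply Set.Subset.antisymm
    · rintro _ rfl
      simp only [mem_iInter]
      exact fun k _ b hb => (phi_iff D _ k b).1 hb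
    · intro y hy
      simp only [mem_iInter] at hy
      have h1 : y ∈ SbarInt D (phi D x) := fun k b hb =>
        subset_closure (hy k (by simp [Tdom, hb]) b hb)
      have h2 := mem_Sbar D (x := x) TLe.rfl
      rw [hρ _ ⟨x, TLe.rfl⟩] at h1 h2
      rw [mem_singleton_iff] at *
      exact h1.trans h2.symm
  rw [← hx] at hopen
  obtain ⟨k, hk⟩ := hfin.exists_notMem
  have hk : phi D x k = TT.bot := by simpa [Tdom] using hk
  have hf : x ∈ closure (D.S k true) := by
    rw [cl_eq]
    intro h
    have := (phi_iff D x k _).2 h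
    rw [hk] at this
    simp at this
  obtain ⟨y, hy, hy'⟩ := mem_closure_iff.1 hf _ hopen rfl
  rw [mem_singleton_iff] at hy
  subst hy
  have := (phi_iff D _ k _).2 hy'
  rw [hk] at this
  simp at this

theorem phi_cont (D : DyadicSubbase X) : Continuous (phi D) := by
  refine continuous_pi fun n => ?_
  refine continuous_generateFrom_iff.2 ?_
  have key : ∀ b, (fun x => phi D x n) ⁻¹' {TT.digit b} = D.S n b := by
    intro b; ext x; simp [phi_iff]
  rintro s (rfl | rfl)
  · rw [key]; exact S_open D _ _
  · rw [key]; exact S_open D _ _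

theorem limits_sub [CompactSpace X] (D : DyadicSubbase X) {K : Set (ℕ → TT)}
    (hK : K ⊆ KhatS D) {I : Set (ℕ → TT)} (hI : IsIdealOf K I) {p : ℕ → TT}
    (hp : IsSupOf I p) (hinf : (Tdom p).Infinite) : p ∈ upX D := by
  let C : ℕ → Set X := fun n => {x | ∀ k, k < n → ∀ b, x ∈ D.S k b → p k = TT.digit b}
  have hne : (⋂ n, C n).Nonempty := by
    apply IsCompact.nonempty_iInter_of_sequence_nonempty_isCompact_isClosed
    · intro n x hx k hk; exact hx k (by omega)
    · intro n
      obtain ⟨k, hk, hnk⟩ := hinf.exists_gt n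
      obtain ⟨b, hb⟩ := (dig (p k)).resolve_left hk
      obtain ⟨e, he, heb⟩ := (hp k b).1 hb
      obtain ⟨q, ⟨x, hx⟩, m, rfl⟩ := hK (hI.1 he)
      have hkm := ((trunc_iff _ _ _ _).1 heb).1
      refine ⟨x, fun j hj c hc => ?_⟩
      exact (hp j c).2 ⟨_, he, (trunc_iff _ _ _ _).2 ⟨by omega, hx j c ((phi_iff D x j c).2 hc)⟩⟩
    · apply IsClosed.isCompact
      simp [C]
    · intro n
      have : C n = ⋂ (k : ℕ) (_ : k < n) (b : Bool) (_ : p k ≠ TT.digit b), (D.S k b)ᶜ := by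
        ext x
        simp only [C, mem_setOf_eq, mem_iInter, mem_compl_iff]
        exact forall₃_congr fun k _ b => ⟨fun h h1 h2 => h1 (h h2), fun h h1 => by_contra fun h2 => h h2 h1⟩
      rw [this]
      exact isClosed_iInter fun k => isClosed_iInter fun _ => isClosed_iInter fun b =>
        isClosed_iInter fun _ => (S_open D k b).isClosed_compl
  obtain ⟨x, hx⟩ := hne
  rw [mem_iInter] at hx
  exact ⟨x, fun k b hb => hx (k+1) k (by omega) b ((phi_iff D x k b).1 hb)⟩

theorem phi_mem (D : DyadicSubbase X) {K : Set (ℕ → TT)} (hK : KS D ⊆ K) (x : X) :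
    ∃ I, IsIdealOf K I ∧ IsSupOf I (phi D x) := by
  refine ⟨{d ∈ K | ∃ m, TLe d (trunc (phi D x) m)}, ⟨fun d hd => hd.1, ?_, ?_, ?_⟩, ?_⟩
  · exact ⟨trunc (phi D x) 0, hK ⟨x, 0, rfl⟩, 0, TLe.rfl⟩
  · rintro d ⟨_, m, hm⟩ e ⟨_, n, hn⟩
    refine ⟨trunc (phi D x) (max m n), ⟨hK ⟨x, _, rfl⟩, _, TLe.rfl⟩, ?_, ?_⟩
    · refine TLe.trans hm fun k b h => ?_
      rw [trunc_iff] at *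
      exact ⟨lt_max_of_lt_left h.1, h.2⟩
    · refine TLe.trans hn fun k b h => ?_
      rw [trunc_iff] at *
      exact ⟨lt_max_of_lt_right h.1, h.2⟩
  · rintro d hd e ⟨_, m, hm⟩ h
    exact ⟨hd, m, TLe.trans h hm⟩
  · intro k b
    constructor
    · intro h
      exact ⟨trunc (phi D x) (k+1), ⟨hK ⟨x, _, rfl⟩, _, TLe.rfl⟩,
        (trunc_iff _ _ _ _).2 ⟨by omega, h⟩⟩
    · rintro ⟨e, ⟨_, m, hm⟩, he⟩
      exact ((trunc_iff _ _ _ _).1 (hm k b he)).2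

theorem rho_cont [CompactSpace X] (D : DyadicSubbase X)
    (ρ : (ℕ → TT) → X) (hρ : ∀ p ∈ upX D, SbarInt D p = {ρ p}) : ContinuousOn ρ (upX D) := by
  intro p hp U hU
  obtain ⟨V, hVU, hV, hpV⟩ := mem_nhds_iff.1 hU
  have hcl : ∀ n, IsClosed (SbarInt D (trunc p n)) := by
    intro n
    have : SbarInt D (trunc p n) =
        ⋂ (k : ℕ) (b : Bool) (_ : trunc p n k = TT.digit b), closure (D.S k b) := by
      ext x; simp [SbarInt]
    rw [this]
    exact isClosed_iInter fun k => isClosed_iInter fun _ => isClosed_iInter fun b => isClosed_closure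
  have hex : ∃ n, SbarInt D (trunc p n) ⊆ V := by
    by_contra hcon
    push Not at hcon
    have hne : (⋂ n, (SbarInt D (trunc p n) ∩ Vᶜ)).Nonempty := by
      apply IsCompact.nonempty_iInter_of_sequence_nonempty_isCompact_isClosed
      · rintro n x ⟨hx, hx'⟩
        refine ⟨fun k b h => hx k b ?_, hx'⟩
        rw [trunc_iff] at *
        exact ⟨by omega, h.2⟩
      · intro n
        obtain ⟨x, hx, hx'⟩ := Set.not_subset.1 (hcon n)
        exact ⟨x, hx, hx'⟩
      · exact ((hcl 0).inter hV.isClosed_compl).isCompact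
      · exact fun n => (hcl n).inter hV.isClosed_compl
    obtain ⟨x, hx⟩ := hne
    rw [mem_iInter] at hx
    have : x ∈ SbarInt D p := fun k b h =>
      (hx (k+1)).1 k b ((trunc_iff _ _ _ _).2 ⟨by omega, h⟩)
    rw [hρ p hp, mem_singleton_iff] at this
    exact (hx 0).2 (this ▸ hpV)
  obtain ⟨n, hn⟩ := hex
  have hdo : ∀ b, IsOpen ({TT.digit b} : Set TT) := by
    intro b
    apply isOpen_generateFrom_of_mem
    cases b <;> simp
  have hop : IsOpen {q : ℕ → TT | TLe (trunc p n) q} := by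
    have : {q : ℕ → TT | TLe (trunc p n) q} =
        ⋂ k ∈ Set.Iio n, {q : ℕ → TT | ∀ b, p k = TT.digit b → q k = TT.digit b} := by
      ext q
      simp only [TLe, trunc_iff, mem_setOf_eq, mem_iInter, mem_Iio, and_imp]
      exact forall_congr' fun k => ⟨fun h h1 b => h b h1, fun h b h1 => h h1 b⟩
    rw [this]
    refine (Set.finite_Iio n).isOpen_biInter fun k _ => ?_
    rcases dig (p k) with h | ⟨b, h⟩
    · simp [h]
    · simp only [h, TT.digit.injEq, forall_eq']
      exact (hdo b).preimage (f := fun q : ℕ → TT => q k) (continuous_apply k)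
  refine Filter.mem_map.2 <| Filter.mem_of_superset (inter_mem_nhdsWithin (upX D) (hop.mem_nhds
    fun k b h => ((trunc_iff _ _ _ _).1 h).2)) ?_
  rintro q ⟨hq, hle⟩
  apply hVU
  apply hn
  have : ρ q ∈ SbarInt D q := by rw [hρ q hq]; rfl
  exact fun k b h => this k b (hle k b h)

end Aux18

/-- Theorem 6.4: if X is compact and S proper, D ∈ {D_S, D̂_S}: X̃ = min(L(D)),
L(D) ⊆ ↑X̃, and ρ_S restricted to L(D) is a continuous retraction onto X with
section the continuous embedding φ_S. -/
theorem stmt_18 {X : Type*} [TopologicalSpace X] [T2Space X] [SecondCountableTopology X]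
    [CompactSpace X] (D : DyadicSubbase X) (hD : IsProperDS D)
    (ρ : (ℕ → TT) → X) (hρ : ∀ p ∈ upX D, SbarInt D p = {ρ p})
    (E : Set (ℕ → TT)) (hE : E = DS D ∨ E = DhatS D) :
    Set.range (phi D) = minOf (limitsOf E) ∧
    limitsOf E ⊆ upX D ∧
    ContinuousOn ρ (limitsOf E) ∧
    ρ '' (limitsOf E) = Set.univ ∧
    (∀ x : X, ρ (phi D x) = x) ∧
    Continuous (phi D) ∧
    Set.range (phi D) ⊆ limitsOf E := by
  have hK : ∃ K, KS D ⊆ K ∧ K ⊆ KhatS D ∧ E = {p | ∃ I, IsIdealOf K I ∧ IsSupOf I p} := by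
    have h0 : KS D ⊆ KhatS D := by
      rintro e ⟨x, m, rfl⟩
      exact ⟨_, ⟨x, Aux18.TLe.rfl⟩, m, rfl⟩
    rcases hE with h | h
    · exact ⟨KS D, Subset.rfl, h0, h⟩
    · exact ⟨KhatS D, h0, Subset.rfl, h⟩
  obtain ⟨K, hK1, hK2, rfl⟩ := hK
  have hsub : limitsOf {p | ∃ I, IsIdealOf K I ∧ IsSupOf I p} ⊆ upX D := by
    rintro p ⟨⟨I, hI, hp⟩, hinf⟩
    exact Aux18.limits_sub D hK2 hI hp hinf
  have hran : Set.range (phi D) ⊆ limitsOf {p | ∃ I, IsIdealOf K I ∧ IsSupOf I p} := by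
    rintro _ ⟨x, rfl⟩
    exact ⟨Aux18.phi_mem D hK1 x, Aux18.dom_infinite D ρ hρ x⟩
  have hle : ∀ (x : X) p, TLe (phi D x) p → ρ p = x := by
    intro x p h
    have := Aux18.mem_Sbar D h
    rw [hρ p ⟨x, h⟩] at this
    exact this.symm
  have hphi : ∀ x : X, ρ (phi D x) = x := fun x => hle x _ Aux18.TLe.rfl
  refine ⟨Subset.antisymm ?_ ?_, hsub, (Aux18.rho_cont D ρ hρ).mono hsub, ?_, hphi,
    Aux18.phi_cont D, hran⟩
  · rintro _ ⟨x, rfl⟩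
    refine ⟨hran ⟨x, rfl⟩, fun q hq hqx => ?_⟩
    obtain ⟨y, hy⟩ := hsub hq
    have h1 := hle y _ (Aux18.TLe.trans hy hqx)
    rw [hphi] at h1
    subst h1
    exact Aux18.TLe.antisymm hqx hy
  · rintro p ⟨hp, hmin⟩
    obtain ⟨x, hx⟩ := hsub hp
    exact ⟨x, hmin _ (hran ⟨x, rfl⟩) hx⟩
  · exact Set.eq_univ_of_forall fun x => ⟨phi D x, hran ⟨x, rfl⟩, hphi x⟩
end

section
/- Suppose X is regular and S is a proper dyadic subbase of X, and let D be either D_S or D̂_S. Then the set ↑X̃ ∩ L(D) = {p ∈ L(D) : x̃ ⊑ p for some x ∈ X} is downwards-closed in L(D): if q ∈ L(D), p ∈ ↑X̃ ∩ L(D) and q ⊑ p, then q ∈ ↑X̃. Moreover, if X is compact, then ↑X̃ ∩ L(D) = L(D). (Corollary 6.5(2)) -/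
open Set Topology TopologicalSpace

variable {X : Type*} [TopologicalSpace X]

theorem aux_open {X : Type*} [TopologicalSpace X] (D : DyadicSubbase X) (n : ℕ) (a : Bool) :
    IsOpen (D.S n a) := by
  rw [D.regOpen]; exact isOpen_interior

theorem aux_phi {X : Type*} [TopologicalSpace X] (D : DyadicSubbase X) (x : X) (k : ℕ) (b : Bool) :
    phi D x k = TT.digit b ↔ x ∈ D.S k b := by
  have h : x ∈ D.S k true → x ∉ D.S k false := by
    intro h h'
    rw [D.compl] at h
    exact h (subset_closure h')
  unfold phi
  cases b <;> split_ifs <;> simp_all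

theorem aux_cl {X : Type*} [TopologicalSpace X] (D : DyadicSubbase X) (x : X) (k : ℕ) (b : Bool)
    (h : x ∉ D.S k (!b)) : x ∈ closure (D.S k b) := by
  cases b
  · rw [show (!false) = true from rfl, D.compl] at h
    exact not_not.1 h
  · rw [D.compl k, closure_compl]
    intro h'
    rw [← D.regOpen] at h'
    exact h h'

theorem aux_nhd {X : Type*} [TopologicalSpace X] (D : DyadicSubbase X) (U : Set X) (hU : IsOpen U) :
    ∀ x ∈ U, ∃ m, Sint D (trunc (phi D x) m) ⊆ U := by
  have mono : ∀ x m n, m ≤ n → Sint D (trunc (phi D x) n) ⊆ Sint D (trunc (phi D x) m) := by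
    intro x m n hmn y hy k b hk
    apply hy k b
    unfold trunc at hk ⊢
    split_ifs at hk with h
    rw [if_pos (by omega)]; exact hk
  rw [← D.subbase] at hU
  change GenerateOpen _ U at hU
  induction hU with
  | basic s hs =>
    obtain ⟨n, a, rfl⟩ := hs
    intro x hx
    refine ⟨n + 1, fun y hy => hy n a ?_⟩
    unfold trunc
    rw [if_pos (by omega)]
    exact (aux_phi D x n a).2 hx
  | univ => exact fun x _ => ⟨0, subset_univ _⟩
  | inter s t _ _ ihs iht =>
    intro x hx
    obtain ⟨m, hm⟩ := ihs x hx.1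
    obtain ⟨n, hn⟩ := iht x hx.2
    exact ⟨max m n, subset_inter ((mono x _ _ (le_max_left m n)).trans hm)
      ((mono x _ _ (le_max_right m n)).trans hn)⟩
  | sUnion T _ ih =>
    rintro x ⟨s, hs, hx⟩
    obtain ⟨m, hm⟩ := ih s hs x hx
    exact ⟨m, hm.trans (subset_sUnion_of_mem hs)⟩

theorem aux_key {X : Type*} [TopologicalSpace X] (D : DyadicSubbase X)
    (E : Set (ℕ → TT)) (hE : E = DS D ∨ E = DhatS D) (q : ℕ → TT) (hq : q ∈ limitsOf E) (n : ℕ) :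
    ∃ x, ∀ k < n, ∀ b, x ∈ D.S k b → q k = TT.digit b := by
  obtain ⟨hqE, hinf⟩ := hq
  have : ∃ I, I ⊆ KhatS D ∧ IsSupOf I q := by
    rcases hE with rfl | rfl
    · obtain ⟨I, hI, hs⟩ := hqE
      refine ⟨I, fun e he => ?_, hs⟩
      obtain ⟨x, m, h⟩ := hI.1 he
      exact ⟨phi D x, ⟨x, fun _ _ h => h⟩, m, h⟩
    · obtain ⟨I, hI, hs⟩ := hqE
      exact ⟨I, hI.1, hs⟩
  obtain ⟨I, hI, hs⟩ := this
  obtain ⟨j, hj, hnj⟩ := hinf.exists_gt n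
  have : ∃ b, q j = TT.digit b := by
    cases h : q j with
    | bot => exact absurd h hj
    | digit b => exact ⟨b, rfl⟩
  obtain ⟨b, hb⟩ := this
  obtain ⟨e, he, hej⟩ := (hs j b).1 hb
  obtain ⟨p, ⟨x, hx⟩, m, rfl⟩ := hI he
  have hjm : j < m := by
    by_contra h
    simp [trunc, h] at hej
  refine ⟨x, fun k hk b hb => (hs k b).2 ⟨_, he, ?_⟩⟩
  unfold trunc
  rw [if_pos (by omega)]
  exact hx k b ((aux_phi D x k b).2 hb)

/-- Corollary 6.5(2): if X is regular and S proper, D ∈ {D_S, D̂_S}: ↑X̃ ∩ L(D)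
is downwards-closed in L(D); if X is moreover compact, ↑X̃ ∩ L(D) = L(D). -/
theorem stmt_19 {X : Type*} [TopologicalSpace X] [T2Space X] [SecondCountableTopology X]
    [RegularSpace X] (D : DyadicSubbase X) (hD : IsProperDS D)
    (E : Set (ℕ → TT)) (hE : E = DS D ∨ E = DhatS D) :
    (∀ p ∈ limitsOf E, p ∈ upX D → ∀ q ∈ limitsOf E, TLe q p → q ∈ upX D) ∧
    (CompactSpace X → ∀ p ∈ limitsOf E, p ∈ upX D) := by
  constructor
  · rintro p - ⟨x, hx⟩ q hq hqp
    refine ⟨x, fun k b hk => ?_⟩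
    rw [aux_phi] at hk
    obtain ⟨V, hV, hVc, hVs⟩ := exists_mem_nhds_isClosed_subset ((aux_open D k b).mem_nhds hk)
    obtain ⟨m, hm⟩ := aux_nhd D (interior V) isOpen_interior x (mem_interior_iff_mem_nhds.2 hV)
    obtain ⟨y, hy⟩ := aux_key D E hE q hq (max m (k + 1))
    refine hy k (by omega) b (hVs ?_)
    have hcl : closure (Sint D (trunc (phi D x) m)) ⊆ V :=
      hVc.closure_subset_iff.2 (hm.trans interior_subset)
    apply hcl
    rw [hD]
    · intro j c hj
      unfold trunc at hj
      split_ifs at hj with hjm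
      apply aux_cl
      intro hyj
      have h1 := hqp j _ (hy j (by omega) _ hyj)
      rw [hx j c hj] at h1
      cases c <;> simp at h1
    · refine (Set.finite_lt_nat m).subset fun j hj => ?_
      by_contra h
      exact hj (if_neg h)
  · intro _ q hq
    choose u hu using aux_key D E hE q hq
    obtain ⟨x, -, hx⟩ := isCompact_univ (X := X) (f := Filter.map u Filter.atTop) (by simp)
    refine ⟨x, fun k b hk => ?_⟩
    rw [aux_phi] at hk
    have hx' : MapClusterPt x Filter.atTop u := hx
    have := hx'.frequently ((aux_open D k b).mem_nhds hk)
    obtain ⟨n, hn, hun⟩ := (this.and_eventually (Filter.eventually_gt_atTop k)).exists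
    exact hu n k hun b hn
end
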